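/- arXiv:1602.06411 — 2 statements merged into one kernel-verified Lean document; each statement's English description precedes it below -/
import Mathlib

section
/- For every sufficiently large even integer n, there exists a simple temporal graph 𝒢 on 3n vertices whose underlying graph has exactly n(n+9)/2 − 3 edges, such that (i) 𝒢 is temporally connected, and (ii) for every subset F of at least 5n edges of the underlying graph, the temporal graph obtained from 𝒢 by deleting all temporal edges on edges of F is not temporally connected. Consequently, every temporally connected spanning subgraph of 𝒢 uses more than n(n+9)/2 − 3 − 5n edges of the underlying graph. -/
/-- Temporal reachability: `TReach A u t v` holds iff there is a temporal path (a walk whose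
temporal edges carry non-decreasing time labels) from `u` to `v` in the set `A` of temporal
edges, all of whose labels are at least `t`. -/
inductive TReach {V : Type*} (A : Set (Sym2 V × ℕ)) : V → ℕ → V → Prop
  | refl (u : V) (t : ℕ) : TReach A u t u
  | step {u v w : V} {t t' : ℕ} :
      (s(u, v), t') ∈ A → t ≤ t' → TReach A v t' w → TReach A u t w

/-- A set of temporal edges is temporally connected iff every ordered pair of vertices is
joined by a temporal path. -/
def TConnected {V : Type*} (A : Set (Sym2 V × ℕ)) : Prop :=
  ∀ u v : V, TReach A u 0 v

open Finset

namespace TemporalSpanner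

section Reachability

variable {V W : Type*}

/-- Reaching `v` by time `t'` is possible when starting from `u` at time `t`, in the sense that
every temporal path leaving `v` at time `t'` or later extends backwards to one leaving `u` at
time `t` or later. -/
def Leads (A : Set (Sym2 V × ℕ)) (u : V) (t : ℕ) (v : V) (t' : ℕ) : Prop :=
  ∀ w, TReach A v t' w → TReach A u t w

lemma Leads.trans {A : Set (Sym2 V × ℕ)} {u v w : V} {r s t : ℕ}
    (h : Leads A u r v s) (h' : Leads A v s w t) : Leads A u r w t :=
  fun z hz => h z (h' z hz)

lemma Leads.wait {A : Set (Sym2 V × ℕ)} (u : V) {t t' : ℕ} (h : t ≤ t') :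
    Leads A u t u t' := by
  intro w hw
  cases hw with
  | refl => exact .refl _ _
  | step he hle hr => exact .step he (h.trans hle) hr

lemma Leads.until {A : Set (Sym2 V × ℕ)} {u v : V} {r s t : ℕ}
    (h : Leads A u r v s) (hst : s ≤ t) : Leads A u r v t :=
  h.trans (Leads.wait v hst)

lemma Leads.edge {A : Set (Sym2 V × ℕ)} {u v : V} {t t' : ℕ} (he : (s(u, v), t') ∈ A)
    (h : t ≤ t') : Leads A u t v t' :=
  fun _ hw => .step he h hw

lemma Leads.reach {A : Set (Sym2 V × ℕ)} {u v : V} {t t' : ℕ} (h : Leads A u t v t') :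
    TReach A u t v :=
  h v (.refl _ _)

lemma exists_of_reach {A : Set (Sym2 V × ℕ)} {P : V → ℕ → Prop}
    (hP : ∀ u v t t', (s(u, v), t') ∈ A → t ≤ t' → P u t → P v t') {u w : V} {t : ℕ}
    (h : TReach A u t w) (hu : P u t) : ∃ t', P w t' := by
  induction h with
  | refl u t => exact ⟨t, hu⟩
  | step he hle _ ih => exact ih (hP _ _ _ _ he hle hu)

lemma reach_map {A : Set (Sym2 V × ℕ)} {B : Set (Sym2 W × ℕ)} (φ : V → W)
    (hφ : ∀ q ∈ A, (Sym2.map φ q.1, q.2) ∈ B) {u v : V} {t : ℕ} (h : TReach A u t v) :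
    TReach B (φ u) t (φ v) := by
  induction h with
  | refl u t => exact .refl _ _
  | step he hle _ ih => exact .step (by simpa using hφ _ he) hle ih

lemma connected_map {A : Set (Sym2 V × ℕ)} {B : Set (Sym2 W × ℕ)} (φ : V → W)
    (hs : Function.Surjective φ) (hφ : ∀ q ∈ A, (Sym2.map φ q.1, q.2) ∈ B)
    (h : TConnected A) : TConnected B := by
  intro u v
  obtain ⟨u, rfl⟩ := hs u
  obtain ⟨v, rfl⟩ := hs v
  exact reach_map φ hφ (h u v)

/-- The temporal edges of the simple temporal graph with edge set `E` and labelling `ℓ`. -/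
def temporalEdges (E : Finset (Sym2 V)) (ℓ : Sym2 V → ℕ) : Set (Sym2 V × ℕ) :=
  {q | q.1 ∈ E ∧ q.2 = ℓ q.1}

/-- There is a temporally connected simple temporal graph on `V` with `m` edges, at least `k` of
which belong to every temporally connected spanning subgraph. -/
def HasRigidGraph (V : Type*) (m k : ℕ) : Prop :=
  ∃ (E K : Finset (Sym2 V)) (ℓ : Sym2 V → ℕ),
    (∀ e ∈ E, ¬ e.IsDiag) ∧ E.card = m ∧ K.card = k ∧ TConnected (temporalEdges E ℓ) ∧
      ∀ E' ⊆ E, TConnected (temporalEdges E' ℓ) → K ⊆ E'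

lemma HasRigidGraph.congr {m k : ℕ} (φ : V ≃ W) (h : HasRigidGraph V m k) :
    HasRigidGraph W m k := by
  obtain ⟨E, K, ℓ, hd, hE, hK, hc, hr⟩ := h
  let ψ : Sym2 V ≃ Sym2 W := ⟨Sym2.map φ, Sym2.map φ.symm,
    fun e => by simp [Sym2.map_map], fun e => by simp [Sym2.map_map]⟩
  have hψ : ∀ e, ψ e = Sym2.map φ e := fun e => rfl
  have hψ' : ∀ e, ψ.symm e = Sym2.map φ.symm e := fun e => rfl
  refine ⟨E.map ψ.toEmbedding, K.map ψ.toEmbedding, ℓ ∘ ψ.symm, ?_, by simpa, by simpa, ?_, ?_⟩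
  · intro e he
    obtain ⟨e, he', rfl⟩ := Finset.mem_map.1 he
    have := hd e he'
    induction e with | _ a b => simpa [hψ] using this
  · refine connected_map φ φ.surjective ?_ hc
    rintro ⟨e, t⟩ ⟨he, ht⟩
    refine ⟨Finset.mem_map.2 ⟨e, he, rfl⟩, ?_⟩
    simpa [← hψ] using ht
  · intro E' hE' hc'
    have hsub : K ⊆ E'.map ψ.symm.toEmbedding := by
      refine hr _ ?_ (connected_map φ.symm φ.symm.surjective ?_ hc')
      · intro e he
        obtain ⟨f, hf, rfl⟩ := Finset.mem_map.1 he
        obtain ⟨e', he', rfl⟩ := Finset.mem_map.1 (hE' hf)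
        simpa using he'
      · rintro ⟨e, t⟩ ⟨he, ht⟩
        refine ⟨Finset.mem_map.2 ⟨e, he, rfl⟩, ?_⟩
        simpa [← hψ'] using ht
    intro e he
    obtain ⟨f, hf, rfl⟩ := Finset.mem_map.1 he
    obtain ⟨e', he', rfl⟩ := Finset.mem_map.1 (hsub hf)
    simpa using he'

end Reachability

section Zigzag

/-- The index of the zigzag Hamiltonian path containing the edge `{a, b}` of the complete graph
on `{0, …, 2N - 1}`; it is half of the residue of `a + b` modulo `2N`. -/
def pathIndex (N a b : ℕ) : ℕ :=
  if a + b < 2 * N then (a + b) / 2 else (a + b - 2 * N) / 2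

/-- The position of the vertex `a` on the `i`-th zigzag Hamiltonian path
`i, i + 1, i - 1, i + 2, i - 2, …, i + N`. -/
def position (N i a : ℕ) : ℕ :=
  if a ≤ i then
    if i - a < N then 2 * (i - a) else 2 * (2 * N + a - i) - 1
  else if a - i ≤ N then 2 * (a - i) - 1 else 2 * (2 * N + i - a)

lemma pathIndex_comm (N a b : ℕ) : pathIndex N a b = pathIndex N b a := by
  simp [pathIndex, Nat.add_comm]

variable {N i a b : ℕ}

lemma position_injective (hi : i < N) (ha : a < 2 * N) (hb : b < 2 * N)
    (h : position N i a = position N i b) : a = b := by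
  unfold position at h
  split_ifs at h <;> omega

lemma position_of_pathIndex_eq (hi : i < N) (ha : a < 2 * N) (hb : b < 2 * N) (hab : a ≠ b)
    (h : pathIndex N a b = i) :
    position N i a + 1 = position N i b ∨ position N i b + 1 = position N i a := by
  unfold pathIndex at h
  unfold position
  split_ifs at h ⊢ <;> omega

lemma exists_position_pred (hi : i < N) (ha : a < 2 * N) {m : ℕ}
    (h : position N i a = m + 1) :
    ∃ b < 2 * N, b ≠ a ∧ position N i b = m ∧ pathIndex N a b = i := by
  refine ⟨if m % 2 = 0 then (if m / 2 ≤ i then i - m / 2 else 2 * N + i - m / 2)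
    else if i + m / 2 + 1 < 2 * N then i + m / 2 + 1 else i + m / 2 + 1 - 2 * N, ?_⟩
  unfold position at h ⊢
  unfold pathIndex
  split_ifs at h ⊢ <;> omega

lemma position_self (hi : i < N) : position N i i = 0 := by
  simp [position]; omega

lemma position_add (hi : i < N) : position N i (i + N) = 2 * N - 1 := by
  unfold position
  split_ifs <;> omega

lemma position_lt (hi : i < N) (ha : a < 2 * N) : position N i a < 2 * N := by
  unfold position
  split_ifs <;> omega

end Zigzag

section Construction

/-- The vertices of the construction: a clique `a`, sources `x` with their gates `v`, targets `y`
with their gates `u`, and two hubs `c` and `d`. -/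
inductive Vertex (M : ℕ)
  | a (i : Fin (2 * (M + 1)))
  | x (i : Fin (M + 1))
  | y (i : Fin (M + 1))
  | u (k : Fin M)
  | v (k : Fin M)
  | c
  | d

namespace Vertex

variable {M : ℕ}

/-- Vertices as elements of a sum of finite types. -/
def equivSum : Vertex M ≃
    Fin (2 * (M + 1)) ⊕ Fin (M + 1) ⊕ Fin (M + 1) ⊕ Fin M ⊕ Fin M ⊕ Bool where
  toFun
    | a i => .inl i
    | x i => .inr (.inl i)
    | y i => .inr (.inr (.inl i))
    | u k => .inr (.inr (.inr (.inl k)))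
    | v k => .inr (.inr (.inr (.inr (.inl k))))
    | c => .inr (.inr (.inr (.inr (.inr false))))
    | d => .inr (.inr (.inr (.inr (.inr true))))
  invFun
    | .inl i => a i
    | .inr (.inl i) => x i
    | .inr (.inr (.inl i)) => y i
    | .inr (.inr (.inr (.inl k))) => u k
    | .inr (.inr (.inr (.inr (.inl k)))) => v k
    | .inr (.inr (.inr (.inr (.inr false)))) => c
    | .inr (.inr (.inr (.inr (.inr true)))) => d
  left_inv w := by cases w <;> rfl
  right_inv w := by rcases w with _ | _ | _ | _ | _ | _ | _ <;> rfl

instance : Fintype (Vertex M) := Fintype.ofEquiv _ equivSum.symm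

noncomputable instance : DecidableEq (Vertex M) := Classical.decEq _

lemma card_eq : Fintype.card (Vertex M) = 3 * (2 * (M + 1)) := by
  rw [Fintype.card_congr equivSum]
  simp
  ring

end Vertex

open Vertex

variable {M : ℕ}

/-- The label of an edge, given with one of its two orientations; it is `0` for the other
orientation unless both ends lie in the clique. -/
def orientedLabel : Vertex M → Vertex M → ℕ
  | a i, a j => pathIndex (M + 1) i j + 1
  | x i, a _ => i + 1
  | y i, a j => if (j : ℕ) = i + (M + 1) then i + 1 else 0
  | v k, d => 4 * M + 12 - 2 * k
  | u k, d => 4 * M + 13 - 2 * k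
  | u _, y _ => 4 * M + 15
  | c, x _ => 4 * M + 16
  | c, v _ => 4 * M + 16
  | d, x _ => 4 * M + 16
  | _, _ => 0

/-- The label of an edge. -/
def label : Sym2 (Vertex M) → ℕ :=
  Sym2.lift ⟨fun p q => max (orientedLabel p q) (orientedLabel q p), fun _ _ => max_comm _ _⟩

lemma label_mk (p q : Vertex M) :
    label s(p, q) = max (orientedLabel p q) (orientedLabel q p) := rfl

/-- The start of the `i`-th Hamiltonian path. -/
def first (i : Fin (M + 1)) : Fin (2 * (M + 1)) := ⟨i, by omega⟩

/-- The end of the `i`-th Hamiltonian path. -/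
def last (i : Fin (M + 1)) : Fin (2 * (M + 1)) := ⟨i + (M + 1), by omega⟩

/-- The edges of the clique. -/
noncomputable def cliqueEdges (M : ℕ) : Finset (Sym2 (Vertex M)) :=
  (⊤ : SimpleGraph (Fin (2 * (M + 1)))).edgeFinset.image (Sym2.map a)

/-- The edges needed to make the clique temporally connected with the other vertices. -/
noncomputable def connectingEdges (M : ℕ) : Finset (Sym2 (Vertex M)) :=
  univ.image (fun i => s(x i, a (first i))) ∪
  (univ.image (fun i => s(y i, a (last i))) ∪
  (univ.image (fun i => s(c, x i)) ∪
  (univ.image (fun i => s(c, y i)) ∪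
  (univ.image (fun k : Fin M => s(x k.succ, v k)) ∪
  (univ.image (fun k : Fin M => s(v k, d)) ∪
  (univ.image (fun k : Fin M => s(u k, d)) ∪
  (univ.image (fun k : Fin M => s(u k, y k.castSucc)) ∪
  (univ.image (fun k : Fin M => s(c, v k)) ∪
  (univ.image (fun k : Fin M => s(c, u k)) ∪
  {s(c, d), s(d, x 0)})))))))))

/-- Edges of label `0`, with the exception of those already present, which serve to adjust the
number of edges. -/
noncomputable def fillerEdges (M : ℕ) : Finset (Sym2 (Vertex M)) :=
  univ.image (fun p : Fin (M + 1) × Fin (2 * (M + 1)) => s(y p.1, a p.2))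

lemma mem_cliqueEdges {e : Sym2 (Vertex M)} :
    e ∈ cliqueEdges M ↔ ∃ i j, i ≠ j ∧ e = s(a i, a j) := by
  simp only [cliqueEdges, mem_image, SimpleGraph.mem_edgeFinset]
  constructor
  · rintro ⟨f, hf, rfl⟩
    induction f with
    | _ i j => exact ⟨i, j, by simpa using hf, rfl⟩
  · rintro ⟨i, j, hij, rfl⟩
    exact ⟨s(i, j), by simpa using hij, rfl⟩

lemma card_cliqueEdges : (cliqueEdges M).card = (M + 1) * (2 * M + 1) := by
  rw [cliqueEdges, card_image_of_injective _ (Sym2.map.injective fun i j h => by simpa using h),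
    SimpleGraph.card_edgeFinset_top_eq_card_choose_two, Fintype.card_fin, Nat.choose_two_right]
  have : 2 * (M + 1) * (2 * (M + 1) - 1) = 2 * ((M + 1) * (2 * M + 1)) := by
    rw [show 2 * (M + 1) - 1 = 2 * M + 1 by omega]; ring
  omega

lemma card_connectingEdges_le : (connectingEdges M).card ≤ 10 * M + 6 := by
  have hF {m : ℕ} (f : Fin m → Sym2 (Vertex M)) : (univ.image f).card ≤ m :=
    card_image_le.trans (by simp)
  have hU {s t : Finset (Sym2 (Vertex M))} {k l : ℕ} (hs : s.card ≤ k) (ht : t.card ≤ l) :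
      (s ∪ t).card ≤ k + l := (card_union_le _ _).trans (add_le_add hs ht)
  refine (hU (hF _) <| hU (hF _) <| hU (hF _) <| hU (hF _) <| hU (hF _) <| hU (hF _) <|
    hU (hF _) <| hU (hF _) <| hU (hF _) <| hU (hF _) card_le_two).trans ?_
  omega

lemma card_fillerEdges : (fillerEdges M).card = (M + 1) * (2 * (M + 1)) := by
  rw [fillerEdges, card_image_of_injective]
  · simp
  · rintro ⟨i, j⟩ ⟨i', j'⟩ h
    simpa using h

lemma disjoint_cliqueEdges_fillerEdges : Disjoint (cliqueEdges M) (fillerEdges M) := by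
  rw [Finset.disjoint_left]
  intro e he hf
  obtain ⟨i, j, -, rfl⟩ := mem_cliqueEdges.1 he
  simp [fillerEdges] at hf

section Connectivity

variable {A : Set (Sym2 (Vertex M) × ℕ)}

lemma leads_clique (hA : ∀ e ∈ cliqueEdges M, (e, label e) ∈ A) (i : Fin (M + 1))
    (j k : Fin (2 * (M + 1))) : Leads A (a j) (i + 1) (a k) (i + 1) := by
  have step (j k : Fin (2 * (M + 1))) (hjk : j ≠ k)
      (h : pathIndex (M + 1) j k = i) : Leads A (a j) (i + 1) (a k) (i + 1) := by
    refine .edge ?_ le_rfl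
    have := hA _ (mem_cliqueEdges.2 ⟨j, k, hjk, rfl⟩)
    simpa [label_mk, orientedLabel, pathIndex_comm _ (k : ℕ), h] using this
  have main (m : ℕ) : ∀ j : Fin (2 * (M + 1)), position (M + 1) i j = m →
      Leads A (a j) (i + 1) (a (first i)) (i + 1) ∧
      Leads A (a (first i)) (i + 1) (a j) (i + 1) := by
    induction m with
    | zero =>
      intro j hj
      have : first i = j := Fin.ext <| position_injective i.2 (first i).2 j.2 <| by
        rw [hj]; exact position_self i.2
      subst this
      exact ⟨.wait _ le_rfl, .wait _ le_rfl⟩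
    | succ m ih =>
      intro j hj
      obtain ⟨b, hb, hbj, hbm, hp⟩ := exists_position_pred i.2 j.2 hj
      have ih := ih ⟨b, hb⟩ hbm
      have hne : j ≠ ⟨b, hb⟩ := fun h => hbj (by rw [h])
      exact ⟨(step j ⟨b, hb⟩ hne hp).trans ih.1,
        ih.2.trans (step ⟨b, hb⟩ j hne.symm (by rwa [pathIndex_comm]))⟩
  exact (main _ j rfl).1.trans (main _ k rfl).2

lemma connected_of_mem (hA : ∀ e ∈ cliqueEdges M, (e, label e) ∈ A)
    (hB : ∀ e ∈ connectingEdges M, (e, label e) ∈ A) : TConnected A := by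
  have edge {p q : Vertex M} (h : s(p, q) ∈ connectingEdges M) {t : ℕ}
      (ht : t ≤ label s(p, q)) : Leads A p t q (label s(p, q)) := .edge (hB _ h) ht
  have edge' {p q : Vertex M} (h : s(p, q) ∈ connectingEdges M) {t : ℕ}
      (ht : t ≤ label s(p, q)) : Leads A q t p (label s(p, q)) :=
    .edge (Sym2.eq_swap ▸ hB _ h) ht
  have xa (i : Fin (M + 1)) : s(x i, a (first i)) ∈ connectingEdges M := by
    simp [connectingEdges]
  have ya (i : Fin (M + 1)) : s(y i, a (last i)) ∈ connectingEdges M := by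
    simp [connectingEdges]
  have cx (i : Fin (M + 1)) : s(c, x i) ∈ connectingEdges M := by
    simp [connectingEdges]
  have cy (i : Fin (M + 1)) : s(c, y i) ∈ connectingEdges M := by
    simp [connectingEdges]
  have xv (k : Fin M) : s(x k.succ, v k) ∈ connectingEdges M := by
    simp [connectingEdges]
  have vd (k : Fin M) : s(v k, d) ∈ connectingEdges M := by
    simp [connectingEdges]
  have ud (k : Fin M) : s(u k, d) ∈ connectingEdges M := by
    simp [connectingEdges]
  have uy (k : Fin M) : s(u k, y k.castSucc) ∈ connectingEdges M := by
    simp [connectingEdges]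
  have cv (k : Fin M) : s(c, v k) ∈ connectingEdges M := by
    simp [connectingEdges]
  have cu (k : Fin M) : s(c, u k) ∈ connectingEdges M := by
    simp [connectingEdges]
  have cd : s(c, d) ∈ connectingEdges M := by
    simp [connectingEdges]
  have dx : s(d, x 0) ∈ connectingEdges M := by
    simp [connectingEdges]
  have lxa (i : Fin (M + 1)) : label s(x i, a (first i)) = i + 1 := by
    simp [label_mk, orientedLabel]
  have lya (i : Fin (M + 1)) : label s(y i, a (last i)) = i + 1 := by
    simp [label_mk, orientedLabel, last]
  have lcx (i : Fin (M + 1)) : label s(c, x i) = 4 * M + 16 := by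
    simp [label_mk, orientedLabel]
  have lcy (i : Fin (M + 1)) : label s(c, y i) = 0 := by
    simp [label_mk, orientedLabel]
  have lxv (k : Fin M) : label s(x k.succ, v k) = 0 := by
    simp [label_mk, orientedLabel]
  have lvd (k : Fin M) : label s(v k, d) = 4 * M + 12 - 2 * k := by
    simp [label_mk, orientedLabel]
  have lud (k : Fin M) : label s(u k, d) = 4 * M + 13 - 2 * k := by
    simp [label_mk, orientedLabel]
  have luy (k : Fin M) : label s(u k, y k.castSucc) = 4 * M + 15 := by
    simp [label_mk, orientedLabel]
  have lcv (k : Fin M) : label s(c, v k) = 4 * M + 16 := by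
    simp [label_mk, orientedLabel]
  have lcu (k : Fin M) : label s(c, u k) = 0 := by
    simp [label_mk, orientedLabel]
  have lcd : label s((c : Vertex M), d) = 0 := by
    simp [label_mk, orientedLabel]
  have ldx : label s((d : Vertex M), x 0) = 4 * M + 16 := by
    simp [label_mk, orientedLabel]
  -- once in the clique at time `i + 1`, all later sources and targets can be reached
  have ay (i : Fin (M + 1)) (j k) (h : i ≤ k) : Leads A (a j) (i + 1) (y k) (4 * M + 15) := by
    have h' : (i : ℕ) ≤ k := h
    refine ((Leads.wait (a j) (by omega)).trans ((leads_clique hA k j (last k)).trans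
      (edge' (ya k) (lya k).ge))).until ?_
    rw [lya]; omega
  have ax (i : Fin (M + 1)) (j k) (h : i ≤ k) : Leads A (a j) (i + 1) (x k) (4 * M + 16) := by
    have h' : (i : ℕ) ≤ k := h
    refine ((Leads.wait (a j) (by omega)).trans ((leads_clique hA k j (first k)).trans
      (edge' (xa k) (lxa k).ge))).until ?_
    rw [lxa]; omega
  have xc (i : Fin (M + 1)) : Leads A (x i) (4 * M + 16) c (4 * M + 16) := by
    simpa [lcx] using edge' (cx i) (lcx i).ge
  have all (w : Vertex M) (hy : ∀ k, Leads A w 0 (y k) (4 * M + 15))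
      (ha : ∀ k, ∃ t, Leads A w 0 (a k) t) (hc : Leads A w 0 c (4 * M + 16))
      (z : Vertex M) : TReach A w 0 z := by
    have hx (i) : Leads A w 0 (x i) (4 * M + 16) := by
      simpa [lcx] using hc.trans (edge (cx i) (lcx i).ge)
    match z with
    | a k => exact (ha k).choose_spec.reach
    | x i => exact (hx i).reach
    | y i => exact (hy i).reach
    | u k => exact ((hy k.castSucc).trans (edge' (uy k) (luy k).ge)).reach
    | v k => exact (hc.trans (edge (cv k) (lcv k).ge)).reach
    | c => exact hc.reach
    | d => exact ((hx 0).trans (edge' dx ldx.ge)).reach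
  have fromA (j z) : TReach A (a j) 0 z := by
    refine all _ (fun k => ?_) (fun k => ⟨(0 : Fin (M + 1)) + 1, ?_⟩) ?_ z
    · exact (Leads.wait _ (Nat.zero_le _)).trans (ay 0 j k (Fin.zero_le _))
    · exact (Leads.wait _ (Nat.zero_le _)).trans (leads_clique hA 0 j k)
    · exact (Leads.wait _ (Nat.zero_le _)).trans ((ax 0 j 0 le_rfl).trans (xc 0))
  have cy' (k) : Leads A c 0 (y k) 0 := by
    simpa [lcy] using edge (cy k) (Nat.zero_le _)
  have fromC (z) : TReach A c 0 z := by
    refine all _ (fun k => (cy' k).until (Nat.zero_le _)) (fun k => ⟨0 + 1, ?_⟩)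
      (.wait _ (Nat.zero_le _)) z
    exact (cy' 0).trans ((edge (ya 0) (Nat.zero_le _)).trans
      (by simpa [lya] using leads_clique hA 0 (last 0) k))
  have toC {w : Vertex M} (h : Leads A w 0 c 0) (z) : TReach A w 0 z := h z (fromC z)
  have fromX (i z) : TReach A (x i) 0 z := by
    have hxa : Leads A (x i) 0 (a (first i)) (i + 1) := by
      simpa [lxa] using edge (xa i) (Nat.zero_le _)
    refine all _ (fun k => ?_) (fun k => ⟨_, hxa.trans (leads_clique hA i _ k)⟩)
      (hxa.trans ((ax i _ i le_rfl).trans (xc i))) z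
    by_cases hk : i ≤ k
    · exact hxa.trans (ay i _ k hk)
    · have hk' : (k : ℕ) < i := by simpa using hk
      obtain ⟨i, rfl⟩ : ∃ i' : Fin M, i = i'.succ := ⟨⟨i - 1, by omega⟩, by ext; simp; omega⟩
      obtain ⟨k, rfl⟩ : ∃ k' : Fin M, k = k'.castSucc := ⟨⟨k, by omega⟩, rfl⟩
      simp only [Fin.val_castSucc, Fin.val_succ] at hk'
      have h1 : Leads A (x i.succ) 0 (v i) 0 := by
        simpa [lxv] using edge (xv i) (Nat.zero_le _)
      have h2 : Leads A (v i) 0 d (4 * M + 12 - 2 * i) := by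
        simpa [lvd] using edge (vd i) (Nat.zero_le _)
      have h3 : Leads A d (4 * M + 12 - 2 * i) (u k) (4 * M + 13 - 2 * k) := by
        simpa [lud] using edge' (ud k) (by rw [lud]; omega)
      have h4 : Leads A (u k) (4 * M + 13 - 2 * k) (y k.castSucc) (4 * M + 15) := by
        simpa [luy] using edge (uy k) (by rw [luy]; omega)
      exact h1.trans (h2.trans (h3.trans h4))
  intro w z
  match w with
  | a k => exact fromA k z
  | x i => exact fromX i z
  | y i => exact toC (by simpa [lcy] using edge' (cy i) (Nat.zero_le _)) z
  | u k => exact toC (by simpa [lcu] using edge' (cu k) (Nat.zero_le _)) z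
  | v k =>
    have h : Leads A (v k) 0 (x k.succ) 0 := by
      simpa [lxv] using edge' (xv k) (Nat.zero_le _)
    exact h z (fromX _ z)
  | c => exact fromC z
  | d => exact toC (by simpa [lcd] using edge' cd (Nat.zero_le _)) z

end Connectivity

section Rigidity

/-- The edges that may be present in the temporal graph. -/
noncomputable def allEdges (M : ℕ) : Finset (Sym2 (Vertex M)) :=
  cliqueEdges M ∪ (connectingEdges M ∪ fillerEdges M)

/-- The vertices and times that can possibly be attained when starting from `x i` at time `0`,
provided that the edge between the positions `m` and `m + 1` of the `i`-th Hamiltonian path is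
missing. -/
def Attainable (i : Fin (M + 1)) (m : ℕ) : Vertex M → ℕ → Prop
  | a k, t => (i : ℕ) + 1 ≤ t ∧ ((i : ℕ) + 2 ≤ t ∨ position (M + 1) i k ≤ m)
  | x j, t => (j : ℕ) = i ∨ (i : ℕ) + 2 ≤ t
  | y j, t => (j : ℕ) ≠ i ∧ (i : ℕ) + 2 ≤ t
  | u k, t => (k : ℕ) ≠ i ∧ 4 * M + 14 ≤ t + 2 * i
  | v k, t => (k : ℕ) + 1 = i ∨ 4 * M + 14 ≤ t + 2 * i
  | c, t => 4 * M + 16 ≤ t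
  | d, t => 4 * M + 14 ≤ t + 2 * i

lemma attainable_of_mem_clique {i : Fin (M + 1)} {m : ℕ} {j k : Fin (2 * (M + 1))}
    (hjk : j ≠ k) (hcut : ¬ (pathIndex (M + 1) j k = i ∧
      position (M + 1) i j = m ∧ position (M + 1) i k = m + 1))
    {t : ℕ} (ht : t ≤ label s(a j, a k)) (hj : Attainable i m (a j) t) :
    Attainable i m (a k) (label s(a j, a k)) := by
  have hl : label s(a j, a k) = pathIndex (M + 1) j k + 1 := by
    simp [label_mk, orientedLabel, pathIndex_comm _ (k : ℕ)]
  rw [hl] at ht ⊢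
  simp only [Attainable] at hj ⊢
  by_cases h : pathIndex (M + 1) j k = i
  · have := position_of_pathIndex_eq i.2 j.2 k.2 (Fin.val_ne_of_ne hjk) h
    omega
  · omega

lemma attainable_of_mem_connecting {i : Fin (M + 1)} {m : ℕ} (hm : m < 2 * M + 1)
    {p q : Vertex M} (he : s(p, q) ∈ connectingEdges M ∪ fillerEdges M)
    {t : ℕ} (ht : t ≤ label s(p, q)) (hp : Attainable i m p t) :
    Attainable i m q (label s(p, q)) := by
  have hi := i.2
  simp only [connectingEdges, fillerEdges, mem_union, mem_image, mem_univ, true_and,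
    mem_insert, mem_singleton, or_assoc] at he
  rcases he with ⟨j, he⟩ | ⟨j, he⟩ | ⟨j, he⟩ | ⟨j, he⟩ | ⟨j, he⟩ | ⟨j, he⟩ | ⟨j, he⟩ | ⟨j, he⟩ |
    ⟨j, he⟩ | ⟨j, he⟩ | he | he | ⟨⟨j, k⟩, he⟩ <;>
  rcases Sym2.eq_iff.1 he with ⟨rfl, rfl⟩ | ⟨rfl, rfl⟩ <;>
  simp [label_mk, orientedLabel, Attainable, first, last] at ht hp ⊢
  all_goals try omega
  all_goals try simp only [Fin.lt_def, Fin.le_def]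
  · by_cases hj : (j : ℕ) = i
    · have := position_self i.2
      rw [hj]
      omega
    · omega
  · by_cases hj : (j : ℕ) = i
    · have := position_add i.2
      rw [hj] at ht hp
      omega
    · omega
  · split_ifs at ht ⊢ with hk
    · by_cases hj : (j : ℕ) = i
      · have := position_add i.2
        rw [hk, hj] at hp
        omega
      · omega
    · omega

lemma cliqueEdges_subset {E : Finset (Sym2 (Vertex M))} (hE : E ⊆ allEdges M)
    (hc : TConnected (temporalEdges E label)) : cliqueEdges M ⊆ E := by
  intro e he
  by_contra heE
  obtain ⟨j, k, hjk, rfl⟩ := mem_cliqueEdges.1 he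
  have hi : pathIndex (M + 1) j k < M + 1 := by
    unfold pathIndex
    split_ifs <;> omega
  wlog hpos : position (M + 1) (pathIndex (M + 1) j k) j + 1 =
      position (M + 1) (pathIndex (M + 1) j k) k generalizing j k
  · have hpos' := position_of_pathIndex_eq hi j.2 k.2 (Fin.val_ne_of_ne hjk) rfl
    rw [pathIndex_comm] at hi hpos hpos'
    exact this k j hjk.symm (Sym2.eq_swap ▸ he) (Sym2.eq_swap ▸ heE) hi
      (hpos'.resolve_left hpos)
  set i : Fin (M + 1) := ⟨pathIndex (M + 1) j k, hi⟩ with hi_def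
  have hm : position (M + 1) i j < 2 * M + 1 := by
    have := position_lt hi k.2
    simp only [hi_def]
    omega
  have hstep (p q : Vertex M) (t t' : ℕ) (h : (s(p, q), t') ∈ temporalEdges E label)
      (ht : t ≤ t') (hp : Attainable i (position (M + 1) i j) p t) :
      Attainable i (position (M + 1) i j) q t' := by
    obtain ⟨hmem, ht'⟩ : s(p, q) ∈ E ∧ t' = label s(p, q) := h
    subst ht'
    rcases mem_union.1 (hE hmem) with h | h
    · obtain ⟨j', k', hjk', h⟩ := mem_cliqueEdges.1 h
      have hcut (j' k') (h : s(a j', a k') ∈ E) : ¬ (pathIndex (M + 1) j' k' = i ∧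
          position (M + 1) i j' = position (M + 1) i j ∧
          position (M + 1) i k' = position (M + 1) i j + 1) := by
        rintro ⟨-, h1, h2⟩
        have e1 := Fin.ext (position_injective hi j'.2 j.2 h1)
        have e2 := Fin.ext (position_injective hi k'.2 k.2 (h2.trans hpos))
        exact heE (e1 ▸ e2 ▸ h)
      rcases Sym2.eq_iff.1 h with ⟨rfl, rfl⟩ | ⟨rfl, rfl⟩
      · exact attainable_of_mem_clique hjk' (hcut _ _ hmem) ht hp
      · exact attainable_of_mem_clique hjk'.symm (hcut _ _ hmem) ht hp
    · exact attainable_of_mem_connecting hm h ht hp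
  obtain ⟨t, ht⟩ := exists_of_reach hstep (hc (x i) (y i)) (Or.inl rfl)
  exact ht.1 rfl

end Rigidity

lemma not_isDiag_of_mem_allEdges {e : Sym2 (Vertex M)} (he : e ∈ allEdges M) : ¬ e.IsDiag := by
  simp only [allEdges, connectingEdges, fillerEdges, mem_union, mem_image, mem_univ, true_and,
    mem_insert, mem_singleton, or_assoc] at he
  rcases he with he | ⟨j, rfl⟩ | ⟨j, rfl⟩ | ⟨j, rfl⟩ | ⟨j, rfl⟩ | ⟨j, rfl⟩ | ⟨j, rfl⟩ |
    ⟨j, rfl⟩ | ⟨j, rfl⟩ | ⟨j, rfl⟩ | ⟨j, rfl⟩ | rfl | rfl | ⟨⟨j, k⟩, rfl⟩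
  · obtain ⟨j, k, hjk, rfl⟩ := mem_cliqueEdges.1 he
    simpa using hjk
  all_goals simp

lemma hasRigidGraph (hM : 4 ≤ M) :
    HasRigidGraph (Vertex M) ((M + 1) * (2 * M + 1) + (10 * M + 7)) ((M + 1) * (2 * M + 1)) := by
  obtain ⟨E, hE, hE', hcard⟩ := exists_subsuperset_card_eq (s := cliqueEdges M ∪ connectingEdges M)
    (t := allEdges M) (n := (M + 1) * (2 * M + 1) + (10 * M + 7))
    (union_subset_union_right subset_union_left)
    ((card_union_le _ _).trans
      (add_le_add card_cliqueEdges.le (card_connectingEdges_le.trans (by omega))))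
    (calc
      _ ≤ (M + 1) * (2 * M + 1) + (M + 1) * (2 * (M + 1)) := by nlinarith
      _ = (cliqueEdges M ∪ fillerEdges M).card := by
        rw [card_union_of_disjoint disjoint_cliqueEdges_fillerEdges, card_cliqueEdges,
          card_fillerEdges]
      _ ≤ (allEdges M).card := card_le_card (union_subset_union_right subset_union_right))
  refine ⟨E, cliqueEdges M, label, fun e he => not_isDiag_of_mem_allEdges (hE' he), hcard,
    card_cliqueEdges, ?_, fun F hF hc => cliqueEdges_subset (hF.trans hE') hc⟩
  exact connected_of_mem (fun e he => ⟨hE (mem_union_left _ he), rfl⟩)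
    (fun e he => ⟨hE (mem_union_right _ he), rfl⟩)

end Construction

end TemporalSpanner

/-- For every sufficiently large even `n` there is a simple temporal graph on
`3n` vertices (given by a loopless edge set `E` with exactly `n(n+9)/2 - 3` edges and a single
time label `ℓ e` on each edge `e ∈ E`) that is temporally connected, while deleting the
temporal edges of any set `F` of at least `5n` underlying edges destroys temporal
connectivity.  Consequently every temporally connected spanning subgraph of it uses more than
`n(n+9)/2 - 3 - 5n` edges of the underlying graph. -/
theorem stmt_2 :
    ∃ N : ℕ, ∀ n : ℕ, N ≤ n → Even n →
      ∃ (E : Finset (Sym2 (Fin (3 * n)))) (ℓ : Sym2 (Fin (3 * n)) → ℕ),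
        (∀ e ∈ E, ¬ e.IsDiag) ∧
        E.card = n * (n + 9) / 2 - 3 ∧
        TConnected {q : Sym2 (Fin (3 * n)) × ℕ | q.1 ∈ E ∧ q.2 = ℓ q.1} ∧
        (∀ F ⊆ E, 5 * n ≤ F.card →
          ¬ TConnected {q : Sym2 (Fin (3 * n)) × ℕ | q.1 ∈ E \ F ∧ q.2 = ℓ q.1}) ∧
        (∀ E' ⊆ E, TConnected {q : Sym2 (Fin (3 * n)) × ℕ | q.1 ∈ E' ∧ q.2 = ℓ q.1} →
          n * (n + 9) / 2 - 3 - 5 * n < E'.card) := by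
  refine ⟨10, fun n hn heven => ?_⟩
  obtain ⟨M, rfl⟩ : ∃ M, n = 2 * (M + 1) := by
    obtain ⟨k, rfl⟩ := heven
    exact ⟨k - 1, by omega⟩
  have hcard : 2 * (M + 1) * (2 * (M + 1) + 9) / 2 = (M + 1) * (2 * M + 1) + 10 * (M + 1) := by
    rw [show 2 * (M + 1) * (2 * (M + 1) + 9) = ((M + 1) * (2 * M + 1) + 10 * (M + 1)) * 2 by ring]
    simp
  have hpos : 3 ≤ (M + 1) * (2 * M + 1) := by nlinarith
  obtain ⟨E, K, ℓ, hd, hE, hK, hc, hr⟩ :=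
    (TemporalSpanner.hasRigidGraph (M := M) (by omega)).congr
      (Fintype.equivFinOfCardEq TemporalSpanner.Vertex.card_eq)
  refine ⟨E, ℓ, hd, by omega, hc, fun F hF hFcard hFc => ?_, fun E' hE' hc' => ?_⟩
  · have h := Finset.card_le_card (hr _ Finset.sdiff_subset hFc)
    rw [Finset.card_sdiff_of_subset hF] at h
    omega
  · have h := Finset.card_le_card (hr _ hE' hc')
    omega
end

section
/- For every sufficiently large even integer n, there exists a simple temporal graph 𝒢 on 3n vertices with Θ(n²) edges such that: (i) 𝒢 is temporally connected; (ii) deleting any subset of at least 5n edges of 𝒢 destroys temporal connectivity (so every temporal connectivity certificate of 𝒢 has Ω(n²) edges); and yet (iii) the temporal graph 𝒢' obtained from 𝒢 by increasing the time label of a single edge admits a temporally connected spanning subgraph with at most 6n edges. -/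
theorem TReach.of_le {V : Type*} {A : Set (Sym2 V × ℕ)} {u v : V} {t t' : ℕ}
    (h : TReach A u t' v) (htt' : t ≤ t') : TReach A u t v := by
  cases h with
  | refl => exact .refl u t
  | step h₁ h₂ h₃ => exact .step h₁ (htt'.trans h₂) h₃

/-- A property of states (vertex, time) preserved by temporal edges holds, at some time, at every
reachable vertex. -/
theorem TReach.exists_of_invariant {V : Type*} {A : Set (Sym2 V × ℕ)} {P : V → ℕ → Prop}
    (hP : ∀ u v t t', P u t → (s(u, v), t') ∈ A → t ≤ t' → P v t')
    {u v : V} {t : ℕ} (h : TReach A u t v) (hu : P u t) : ∃ t', P v t' := by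
  induction h with
  | refl u t => exact ⟨t, hu⟩
  | step h₁ h₂ _ ih => exact ih (hP _ _ _ _ hu h₁ h₂)

/-- Moving along a path all of whose edges carry the same label, in either direction. -/
theorem TReach.along {V : Type*} {A : Set (Sym2 V × ℕ)} {p : ℕ → V} {m τ : ℕ}
    (hp : ∀ r < m, (s(p r, p (r + 1)), τ) ∈ A) {z : V} {r r' : ℕ} (hr : r ≤ m) (hr' : r' ≤ m)
    (h : TReach A (p r') τ z) : TReach A (p r) τ z := by
  have h₀ : TReach A (p 0) τ z := by
    clear hr r
    induction r' with
    | zero => exact h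
    | succ k ih => exact ih (by omega) (.step (hp k (by omega)) le_rfl h)
  induction r with
  | zero => exact h₀
  | succ k ih =>
    refine .step (v := p k) ?_ le_rfl (ih (by omega))
    rw [Sym2.eq_swap]
    exact hp k (by omega)

theorem TReach.map {V W : Type*} {A : Set (Sym2 V × ℕ)} {B : Set (Sym2 W × ℕ)} (f : V → W)
    (hf : ∀ e t, (e, t) ∈ A → (Sym2.map f e, t) ∈ B) {u v : V} {t : ℕ}
    (h : TReach A u t v) : TReach B (f u) t (f v) := by
  induction h with
  | refl u t => exact .refl _ _
  | step h₁ h₂ _ ih => exact .step (by simpa using hf _ _ h₁) h₂ ih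

/-- The set of temporal edges of the simple temporal graph with edges `E` and labels `ℓ`. -/
abbrev labelledEdges {V : Type*} (E : Finset (Sym2 V)) (ℓ : Sym2 V → ℕ) : Set (Sym2 V × ℕ) :=
  {q | q.1 ∈ E ∧ q.2 = ℓ q.1}

/-- The equivalence of unordered pairs induced by an equivalence. -/
def sym2Equiv {V W : Type*} (φ : V ≃ W) : Sym2 V ≃ Sym2 W where
  toFun := Sym2.map φ
  invFun := Sym2.map φ.symm
  left_inv e := by simp [Sym2.map_map]
  right_inv e := by simp [Sym2.map_map]

theorem tConnected_map {V W : Type*} (φ : V ≃ W) {E : Finset (Sym2 V)} {ℓ : Sym2 V → ℕ} :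
    TConnected (labelledEdges (E.map (sym2Equiv φ).toEmbedding) (ℓ ∘ (sym2Equiv φ).symm)) ↔
      TConnected (labelledEdges E ℓ) := by
  constructor
  · intro h u v
    have := (h (φ u) (φ v)).map (B := labelledEdges E ℓ) φ.symm ?_
    · simpa using this
    · rintro e t ⟨h₁, h₂⟩
      obtain ⟨e, he, rfl⟩ := Finset.mem_map.1 h₁
      have : Sym2.map φ.symm (sym2Equiv φ e) = e := (sym2Equiv φ).symm_apply_apply e
      simp_all
  · intro h u v
    have := (h (φ.symm u) (φ.symm v)).map
      (B := labelledEdges (E.map (sym2Equiv φ).toEmbedding) (ℓ ∘ (sym2Equiv φ).symm)) φ ?_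
    · simpa using this
    · rintro e t ⟨h₁, h₂⟩
      have : (sym2Equiv φ).symm (Sym2.map φ e) = e := (sym2Equiv φ).symm_apply_apply e
      refine ⟨Finset.mem_map_of_mem _ h₁, ?_⟩
      simp_all

namespace FragileGraph

/-- Vertices: a core carrying edge-disjoint Hamiltonian paths, a source and a sink (each with an
auxiliary vertex) for every path, and two hubs. -/
inductive Vtx (g : ℕ)
  | core (x : Fin (2 * g + 10))
  | src (i : Fin g)
  | srcAux (i : Fin g)
  | snk (i : Fin g)
  | snkAux (i : Fin g)
  | mid
  | hub

open Vtx

def vtxEquiv (g : ℕ) :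
    Vtx g ≃ Fin (2 * g + 10) ⊕ Fin g ⊕ Fin g ⊕ Fin g ⊕ Fin g ⊕ Unit ⊕ Unit where
  toFun
    | core x => .inl x
    | src i => .inr (.inl i)
    | srcAux i => .inr (.inr (.inl i))
    | snk i => .inr (.inr (.inr (.inl i)))
    | snkAux i => .inr (.inr (.inr (.inr (.inl i))))
    | mid => .inr (.inr (.inr (.inr (.inr (.inl ())))))
    | hub => .inr (.inr (.inr (.inr (.inr (.inr ())))))
  invFun
    | .inl x => core x
    | .inr (.inl i) => src i
    | .inr (.inr (.inl i)) => srcAux i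
    | .inr (.inr (.inr (.inl i))) => snk i
    | .inr (.inr (.inr (.inr (.inl i)))) => snkAux i
    | .inr (.inr (.inr (.inr (.inr (.inl ()))))) => mid
    | .inr (.inr (.inr (.inr (.inr (.inr ()))))) => hub
  left_inv v := by cases v <;> rfl
  right_inv v := by rcases v with _ | _ | _ | _ | _ | _ | _ <;> rfl

variable {g : ℕ}

instance : DecidableEq (Vtx g) := (vtxEquiv g).decidableEq

/-- The vertices `i, i + 1, i - 1, i + 2, i - 2, …` (modulo `2 * g + 10`) of the `i`-th Hamiltonian
path of the core. -/
def pathVtx (i : Fin g) (r : ℕ) : Fin (2 * g + 10) :=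
  ⟨min (2 * g + 9)
    (if r % 2 = 0 then (if r / 2 ≤ i then i - r / 2 else i + (2 * g + 10) - r / 2)
      else (if i + (r + 1) / 2 < 2 * g + 10 then i + (r + 1) / 2
        else i + (r + 1) / 2 - (2 * g + 10))), by omega⟩

/-- The offset of `x` from `i` modulo `2 * g + 10`. -/
def offset (i : Fin g) (x : Fin (2 * g + 10)) : ℕ :=
  if i.val ≤ x then x - i else x + (2 * g + 10) - i

/-- The position of `x` on the `i`-th Hamiltonian path. -/
def pos (i : Fin g) (x : Fin (2 * g + 10)) : ℕ :=
  if offset i x = 0 then 0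
  else if offset i x ≤ g + 5 then 2 * offset i x - 1 else 2 * (2 * g + 10 - offset i x)

theorem pos_pathVtx (i : Fin g) {r : ℕ} (hr : r ≤ 2 * g + 9) : pos i (pathVtx i r) = r := by
  have := i.2
  simp only [pos, offset, pathVtx]
  split_ifs <;> omega

theorem pos_le (i : Fin g) (x : Fin (2 * g + 10)) : pos i x ≤ 2 * g + 9 := by
  have := i.2
  have := x.2
  simp only [pos, offset]
  split_ifs <;> omega

theorem pathVtx_pos (i : Fin g) (x : Fin (2 * g + 10)) : pathVtx i (pos i x) = x := by
  have := i.2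
  have := x.2
  ext
  simp only [pos, offset, pathVtx]
  split_ifs <;> omega

def labelFun (g : ℕ) : Vtx g → Vtx g → ℕ
  | core x, core y => 2 * g + 3 +
      (if x.val + y.val < 2 * g + 10 then x.val + y.val else x.val + y.val - (2 * g + 10)) / 2
  | src _, srcAux _ | srcAux _, src _ => 1
  | src i, mid | mid, src i => 2 * (g - i) + 1
  | snk i, mid | mid, snk i => 2 * (g - i)
  | core _, srcAux i | srcAux i, core _ | core _, snkAux i | snkAux i, core _ => 2 * g + 3 + i
  | core x, hub | hub, core x => if x.val = 0 then 0 else 4 * g + 10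
  | snkAux _, snk _ | snk _, snkAux _ | hub, mid | mid, hub | hub, src _ | src _, hub
  | hub, srcAux _ | srcAux _, hub => 4 * g + 10
  | _, _ => 0

def label (g : ℕ) : Sym2 (Vtx g) → ℕ :=
  Sym2.lift ⟨labelFun g, fun u v => by
    cases u <;> cases v <;> simp [labelFun, add_comm]⟩

@[simp] theorem label_mk (u v : Vtx g) : label g s(u, v) = labelFun g u v := rfl

def coreEdge (i : Fin g) (r : ℕ) : Sym2 (Vtx g) :=
  s(core (pathVtx i r), core (pathVtx i (r + 1)))

theorem label_coreEdge (i : Fin g) {r : ℕ} (hr : r < 2 * g + 9) :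
    label g (coreEdge i r) = 2 * g + 3 + i := by
  have := i.2
  simp only [coreEdge, label_mk, labelFun, pathVtx]
  split_ifs <;> omega

theorem coreEdge_injective {i j : Fin g} {r q : ℕ} (hr : r < 2 * g + 9) (hq : q < 2 * g + 9)
    (h : coreEdge i r = coreEdge j q) : i = j ∧ r = q := by
  have hij : i = j := by
    have := congrArg (label g) h
    rw [label_coreEdge i hr, label_coreEdge j hq] at this
    ext
    omega
  subst hij
  refine ⟨rfl, ?_⟩
  simp only [coreEdge, Sym2.eq_iff, core.injEq] at h
  have h₁ := pos_pathVtx i (r := r) (by omega)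
  have h₂ := pos_pathVtx i (r := r + 1) (by omega)
  have h₃ := pos_pathVtx i (r := q) (by omega)
  have h₄ := pos_pathVtx i (r := q + 1) (by omega)
  rcases h with ⟨h, h'⟩ | ⟨h, h'⟩ <;> rw [h] at h₁ <;> rw [h'] at h₂ <;> omega

/-- The edges of the `i`-th Hamiltonian path. -/
def pathEdges (i : Fin g) : Finset (Sym2 (Vtx g)) :=
  (Finset.range (2 * g + 9)).image (coreEdge i)

def coreEdges (g : ℕ) : Finset (Sym2 (Vtx g)) :=
  Finset.univ.biUnion pathEdges

/-- The edges incident to the source and the sink of the `i`-th path or to their auxiliary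
vertices. -/
def gadgetEdges (i : Fin g) : Finset (Sym2 (Vtx g)) :=
  [s(src i, srcAux i), s(src i, mid), s(mid, snk i), s(srcAux i, core (pathVtx i 0)),
    s(core (pathVtx i (2 * g + 9)), snkAux i), s(snkAux i, snk i), s(hub, snk i),
    s(hub, snkAux i), s(hub, src i), s(hub, srcAux i)].toFinset

def hubEdges (g : ℕ) : Finset (Sym2 (Vtx g)) :=
  [s(hub, core 0), s(hub, core 1), s(mid, core 0), s(mid, hub)].toFinset

def outerEdges (g : ℕ) : Finset (Sym2 (Vtx g)) :=
  Finset.univ.biUnion gadgetEdges ∪ hubEdges g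

theorem card_pathEdges_le (i : Fin g) : (pathEdges i).card ≤ 2 * g + 9 :=
  Finset.card_image_le.trans (by simp)

theorem card_coreEdges : (coreEdges g).card = g * (2 * g + 9) := by
  rw [coreEdges, Finset.card_biUnion]
  · have h (i : Fin g) : (pathEdges i).card = 2 * g + 9 := by
      rw [pathEdges, Finset.card_image_of_injOn, Finset.card_range]
      intro r hr q hq h
      simp only [Finset.coe_range, Set.mem_Iio] at hr hq
      exact (coreEdge_injective hr hq h).2
    simp [h]
  · intro i _ j _ hij
    rw [Function.onFun, Finset.disjoint_left]
    intro e hi hj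
    simp only [pathEdges, Finset.mem_image, Finset.mem_range] at hi hj
    obtain ⟨r, hr, rfl⟩ := hi
    obtain ⟨q, hq, h⟩ := hj
    exact hij (coreEdge_injective hq hr h).1.symm

theorem card_outerEdges_le : (outerEdges g).card ≤ 10 * g + 4 := by
  refine (Finset.card_union_le _ _).trans (Nat.add_le_add ?_ (List.toFinset_card_le _))
  refine (Finset.card_biUnion_le_card_mul _ _ 10 fun i _ => List.toFinset_card_le _).trans ?_
  simp [mul_comm]

theorem not_isDiag {e : Sym2 (Vtx g)} (he : e ∈ coreEdges g ∪ outerEdges g) : ¬ e.IsDiag := by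
  simp only [coreEdges, pathEdges, outerEdges, gadgetEdges, hubEdges, Finset.mem_union,
    Finset.mem_biUnion, Finset.mem_univ, true_and, Finset.mem_image, Finset.mem_range,
    List.mem_toFinset, List.mem_cons, List.not_mem_nil, or_false] at he
  rcases he with ⟨i, r, hr, rfl⟩ | ⟨i, h⟩ | h
  · have h₁ := pos_pathVtx i (r := r) (by omega)
    have h₂ := pos_pathVtx i (r := r + 1) (by omega)
    simp only [coreEdge, Sym2.mk_isDiag_iff, core.injEq]
    intro h
    rw [h] at h₁
    omega
  · rcases h with rfl | rfl | rfl | rfl | rfl | rfl | rfl | rfl | rfl | rfl <;> simp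
  · rcases h with rfl | rfl | rfl | rfl <;> simp

/-- The states reachable from the `i`-th source when the `r`-th edge of the `i`-th path is
missing. -/
def Inv (i : Fin g) (r : ℕ) : Vtx g → ℕ → Prop
  | core x, t => 2 * g + 3 + i ≤ t ∧ (t ≤ 2 * g + 3 + i → pos i x ≤ r)
  | src j, t => j = i ∨ 2 * (g - i) + 1 ≤ t
  | srcAux j, t => j = i ∨ 2 * g + 3 + i < t
  | snk j, t => j ≠ i ∧ 2 * (g - i) + 1 ≤ t
  | snkAux j, t => j ≠ i ∧ 2 * g + 3 + i ≤ t
  | mid, t => 2 * (g - i) + 1 ≤ t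
  | hub, t => 4 * g + 10 ≤ t

theorem coreEdges_subset {E' : Finset (Sym2 (Vtx g))} (hE : E' ⊆ coreEdges g ∪ outerEdges g)
    (h : TConnected (labelledEdges E' (label g))) : coreEdges g ⊆ E' := by
  intro e he
  by_contra hne
  simp only [coreEdges, pathEdges, Finset.mem_biUnion, Finset.mem_univ, true_and, Finset.mem_image,
    Finset.mem_range] at he
  obtain ⟨i, r, hr, rfl⟩ := he
  suffices hP : ∀ u v t t', Inv i r u t → (s(u, v), t') ∈ labelledEdges E' (label g) → t ≤ t' →
      Inv i r v t' by
    obtain ⟨t, ht⟩ := (h (src i) (snk i)).exists_of_invariant hP (by simp [Inv])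
    simp [Inv] at ht
  rintro u v t t' hu ⟨hE', hl⟩ htt'
  have he := hE hE'
  dsimp only at hl hE' he
  have hi := i.2
  simp only [coreEdges, pathEdges, outerEdges, gadgetEdges, hubEdges, Finset.mem_union,
    Finset.mem_biUnion, Finset.mem_univ, true_and, Finset.mem_image, Finset.mem_range,
    List.mem_toFinset, List.mem_cons, List.not_mem_nil, or_false] at he
  rcases he with ⟨j, q, hq, he⟩ | ⟨j, he⟩ | he
  · rw [← he, label_coreEdge j hq] at hl
    have hjr : j = i → q ≠ r := by
      rintro rfl rfl
      exact hne (he ▸ hE')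
    simp only [coreEdge, Sym2.eq_iff] at he
    have h₁ := pos_pathVtx j (r := q) (by omega)
    have h₂ := pos_pathVtx j (r := q + 1) (by omega)
    rcases he with ⟨rfl, rfl⟩ | ⟨rfl, rfl⟩ <;> simp only [Inv] at hu ⊢ <;>
    · refine ⟨by omega, fun hle => ?_⟩
      obtain rfl : j = i := by
        ext
        omega
      have := hjr rfl
      have := hu.2 (by omega)
      omega
  · have hj := j.2
    have h₁ := pos_pathVtx j (r := 0) (by omega)
    have h₂ := pos_pathVtx j (r := 2 * g + 9) (by omega)
    by_cases hji : j = i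
    · subst hji
      simp only [Sym2.eq_iff] at he
      rcases he with (⟨rfl, rfl⟩ | ⟨rfl, rfl⟩) | (⟨rfl, rfl⟩ | ⟨rfl, rfl⟩) |
        (⟨rfl, rfl⟩ | ⟨rfl, rfl⟩) | (⟨rfl, rfl⟩ | ⟨rfl, rfl⟩) | (⟨rfl, rfl⟩ | ⟨rfl, rfl⟩) |
        (⟨rfl, rfl⟩ | ⟨rfl, rfl⟩) | (⟨rfl, rfl⟩ | ⟨rfl, rfl⟩) | (⟨rfl, rfl⟩ | ⟨rfl, rfl⟩) |
        (⟨rfl, rfl⟩ | ⟨rfl, rfl⟩) | (⟨rfl, rfl⟩ | ⟨rfl, rfl⟩) <;>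
      simp only [Inv, label_mk, labelFun] at * <;> simp at * <;> omega
    · have hji' : j.val ≠ i.val := fun h => hji (Fin.ext h)
      simp only [Sym2.eq_iff] at he
      rcases he with (⟨rfl, rfl⟩ | ⟨rfl, rfl⟩) | (⟨rfl, rfl⟩ | ⟨rfl, rfl⟩) |
        (⟨rfl, rfl⟩ | ⟨rfl, rfl⟩) | (⟨rfl, rfl⟩ | ⟨rfl, rfl⟩) | (⟨rfl, rfl⟩ | ⟨rfl, rfl⟩) |
        (⟨rfl, rfl⟩ | ⟨rfl, rfl⟩) | (⟨rfl, rfl⟩ | ⟨rfl, rfl⟩) | (⟨rfl, rfl⟩ | ⟨rfl, rfl⟩) |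
        (⟨rfl, rfl⟩ | ⟨rfl, rfl⟩) | (⟨rfl, rfl⟩ | ⟨rfl, rfl⟩) <;>
      simp only [Inv, label_mk, labelFun, hji, false_or, ne_eq, not_false_eq_true, true_and] at * <;>
      omega
  · simp only [Sym2.eq_iff] at he
    rcases he with (⟨rfl, rfl⟩ | ⟨rfl, rfl⟩) | (⟨rfl, rfl⟩ | ⟨rfl, rfl⟩) |
        (⟨rfl, rfl⟩ | ⟨rfl, rfl⟩) | (⟨rfl, rfl⟩ | ⟨rfl, rfl⟩) <;>
      simp [Inv, labelFun] at * <;> omega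

section Reachability

variable {A : Set (Sym2 (Vtx g) × ℕ)}

theorem reach_core_along {i : Fin g} {τ : ℕ} (hp : ∀ r < 2 * g + 9, (coreEdge i r, τ) ∈ A)
    (x y : Fin (2 * g + 10)) {z : Vtx g} (h : TReach A (core y) τ z) :
    TReach A (core x) τ z := by
  rw [← pathVtx_pos i x]
  rw [← pathVtx_pos i y] at h
  exact h.along (p := fun r => core (pathVtx i r)) hp (pos_le i x) (pos_le i y)

/-- All outer edges, except possibly the one between `mid` and the core, are present with their
label. -/
def HasOuter (A : Set (Sym2 (Vtx g) × ℕ)) : Prop :=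
  ∀ e ∈ outerEdges g, e ≠ s(mid, core 0) → (e, label g e) ∈ A

theorem HasOuter.step (hA : HasOuter A) {u v w : Vtx g} {t : ℕ}
    (he : s(u, v) ∈ outerEdges g ∧ s(u, v) ≠ s(mid, core 0)) (ht : t ≤ labelFun g u v)
    (h : TReach A v (labelFun g u v) w) : TReach A u t w :=
  .step (hA _ he.1 he.2) ht h

theorem HasOuter.reach_hub (hA : HasOuter A) {t : ℕ} (ht : t ≤ 4 * g + 10) {z : Vtx g}
    (h : TReach A hub (4 * g + 10) z) : TReach A (core 1) t z :=
  hA.step (v := hub) (by simp [outerEdges, gadgetEdges, hubEdges]) (by simpa [labelFun] using ht)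
    (by simpa [labelFun] using h)

theorem HasOuter.hub_mid (hA : HasOuter A) : TReach A hub (4 * g + 10) mid :=
  hA.step (v := mid) (by simp [outerEdges, gadgetEdges, hubEdges]) (by simp [labelFun]) (.refl _ _)

theorem HasOuter.hub_src (hA : HasOuter A) (j : Fin g) : TReach A hub (4 * g + 10) (src j) :=
  hA.step (v := src j) (by simp [outerEdges, gadgetEdges, hubEdges]) (by simp [labelFun])
    (.refl _ _)

theorem HasOuter.hub_srcAux (hA : HasOuter A) (j : Fin g) :
    TReach A hub (4 * g + 10) (srcAux j) :=
  hA.step (v := srcAux j) (by simp [outerEdges, gadgetEdges, hubEdges]) (by simp [labelFun])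
    (.refl _ _)

theorem HasOuter.core_snkAux (hA : HasOuter A) {j : Fin g} {t : ℕ} (ht : t ≤ 2 * g + 3 + j) :
    TReach A (core (pathVtx j (2 * g + 9))) t (snkAux j) :=
  hA.step (v := snkAux j) (by simp [outerEdges, gadgetEdges, hubEdges])
    (by simpa [labelFun] using ht) (.refl _ _)

theorem HasOuter.core_snk (hA : HasOuter A) {j : Fin g} {t : ℕ} (ht : t ≤ 2 * g + 3 + j) :
    TReach A (core (pathVtx j (2 * g + 9))) t (snk j) :=
  hA.step (v := snkAux j) (by simp [outerEdges, gadgetEdges, hubEdges])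
    (by simpa [labelFun] using ht)
    (hA.step (v := snk j) (by simp [outerEdges, gadgetEdges, hubEdges])
      (by simp only [labelFun]; omega) (.refl _ _))

theorem HasOuter.reach_of_path (hA : HasOuter A) {i : Fin g}
    (hp : ∀ r < 2 * g + 9, (coreEdge i r, 2 * g + 3 + i.val) ∈ A) (x : Fin (2 * g + 10))
    {v : Vtx g} (hv : ∀ j, v = snk j ∨ v = snkAux j → i ≤ j) :
    TReach A (core x) (2 * g + 3 + i) v := by
  have hi : 2 * g + 3 + i.val ≤ 4 * g + 10 := by omega
  cases v with
  | core y => exact reach_core_along hp x y (.refl _ _)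
  | src j => exact reach_core_along hp x 1 (hA.reach_hub hi (hA.hub_src j))
  | srcAux j => exact reach_core_along hp x 1 (hA.reach_hub hi (hA.hub_srcAux j))
  | snk j =>
    have : i.val ≤ j := hv j (.inl rfl)
    exact reach_core_along hp x _ (hA.core_snk (by omega))
  | snkAux j =>
    have : i.val ≤ j := hv j (.inr rfl)
    exact reach_core_along hp x _ (hA.core_snkAux (by omega))
  | mid => exact reach_core_along hp x 1 (hA.reach_hub hi hA.hub_mid)
  | hub => exact reach_core_along hp x 1 (hA.reach_hub hi (.refl _ _))

theorem HasOuter.reach_of_first_path (hA : HasOuter A) {i : Fin g} (hi : i.val = 0)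
    (hp : ∀ r < 2 * g + 9, (coreEdge i r, 2 * g + 3 + i.val) ∈ A) {t : ℕ} (ht : t ≤ 2 * g + 3)
    (x : Fin (2 * g + 10)) (v : Vtx g) : TReach A (core x) t v :=
  (hA.reach_of_path hp x fun j _ => Fin.le_def.2 (by omega)).of_le (by omega)

theorem HasOuter.tConnected (hA : HasOuter A) {i : Fin g} (hi : i.val = 0)
    (hp : ∀ r < 2 * g + 9, (coreEdge i r, 2 * g + 3 + i.val) ∈ A) {τ : ℕ} (hτ : τ ≤ 2 * g + 3)
    (hmid : (s(mid, core 0), τ) ∈ A) (hsrc : ∀ j v, TReach A (src j) 1 v) : TConnected A := by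
  intro u v
  have hhub : TReach A hub 0 v :=
    hA.step (v := core 0) (by simp [outerEdges, gadgetEdges, hubEdges]) (by simp)
      (hA.reach_of_first_path hi hp (by simp [labelFun]) _ _)
  cases u with
  | core x => exact hA.reach_of_first_path hi hp (by simp) _ _
  | src j => exact (hsrc j v).of_le (by simp)
  | srcAux j =>
    exact hA.step (v := src j) (by simp [outerEdges, gadgetEdges, hubEdges]) (by simp) (hsrc j v)
  | snk j =>
    exact hA.step (v := hub) (by simp [outerEdges, gadgetEdges, hubEdges]) (by simp) hhub
  | snkAux j =>
    exact hA.step (v := hub) (by simp [outerEdges, gadgetEdges, hubEdges]) (by simp) hhub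
  | mid => exact .step hmid (by simp) (hA.reach_of_first_path hi hp hτ _ _)
  | hub => exact hhub

end Reachability

theorem coreEdge_mem_pathEdges (i : Fin g) {r : ℕ} (hr : r < 2 * g + 9) :
    coreEdge i r ∈ pathEdges i :=
  Finset.mem_image_of_mem _ (Finset.mem_range.2 hr)

theorem pathEdges_subset (i : Fin g) : pathEdges i ⊆ coreEdges g :=
  Finset.subset_biUnion_of_mem pathEdges (Finset.mem_univ i)

theorem tConnected_graph (hg : 0 < g) :
    TConnected (labelledEdges (coreEdges g ∪ outerEdges g) (label g)) := by
  have hA : HasOuter (labelledEdges (coreEdges g ∪ outerEdges g) (label g)) :=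
    fun e he _ => ⟨Finset.mem_union_right _ he, rfl⟩
  have hp (i : Fin g) (r : ℕ) (hr : r < 2 * g + 9) : (coreEdge i r, 2 * g + 3 + i.val) ∈
      labelledEdges (coreEdges g ∪ outerEdges g) (label g) :=
    ⟨Finset.mem_union_left _ (pathEdges_subset i (coreEdge_mem_pathEdges i hr)),
      (label_coreEdge i hr).symm⟩
  refine hA.tConnected (i := ⟨0, hg⟩) rfl (hp _) (τ := 0) (by simp)
    ⟨by simp [outerEdges, hubEdges], by simp [labelFun]⟩ fun i v => ?_
  by_cases hv : ∀ j, v = snk j ∨ v = snkAux j → i ≤ j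
  · exact hA.step (v := srcAux i) (by simp [outerEdges, gadgetEdges, hubEdges]) (by simp [labelFun])
      (hA.step (v := core (pathVtx i 0)) (by simp [outerEdges, gadgetEdges, hubEdges])
        (by simp only [labelFun]; omega) (hA.reach_of_path (hp i) _ hv))
  · push Not at hv
    obtain ⟨j, hv, hji⟩ := hv
    have hji' : j.val < i := hji
    have hi := i.2
    refine hA.step (v := mid) (by simp [outerEdges, gadgetEdges, hubEdges])
      (by simp only [labelFun]; omega)
      (hA.step (v := snk j) (by simp [outerEdges, gadgetEdges, hubEdges])
        (by simp only [labelFun]; omega) ?_)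
    rcases hv with rfl | rfl
    · exact .refl _ _
    · exact hA.step (v := snkAux j) (by simp [outerEdges, gadgetEdges, hubEdges])
        (by simp only [labelFun]; omega) (.refl _ _)

theorem tConnected_update {i : Fin g} (hi : i.val = 0) :
    TConnected (labelledEdges (pathEdges i ∪ outerEdges g)
      (Function.update (label g) s(mid, core 0) (2 * g + 2))) := by
  have hA : HasOuter (labelledEdges (pathEdges i ∪ outerEdges g)
      (Function.update (label g) s(mid, core 0) (2 * g + 2))) :=
    fun e he hne => ⟨Finset.mem_union_right _ he, by simp [hne]⟩
  have hp (r : ℕ) (hr : r < 2 * g + 9) : (coreEdge i r, 2 * g + 3 + i.val) ∈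
      labelledEdges (pathEdges i ∪ outerEdges g)
        (Function.update (label g) s(mid, core 0) (2 * g + 2)) := by
    refine ⟨Finset.mem_union_left _ (coreEdge_mem_pathEdges i hr), ?_⟩
    rw [Function.update_of_ne (by simp [coreEdge]), label_coreEdge i hr]
  have hmid : (s(mid, core 0), 2 * g + 2) ∈ labelledEdges (pathEdges i ∪ outerEdges g)
      (Function.update (label g) s(mid, core 0) (2 * g + 2)) :=
    ⟨by simp [outerEdges, hubEdges], by simp⟩
  refine hA.tConnected hi hp (by omega) hmid fun j v => ?_
  exact hA.step (v := mid) (by simp [outerEdges, gadgetEdges, hubEdges])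
    (by simp only [labelFun]; omega)
    (.step hmid (by simp only [labelFun]; omega) (hA.reach_of_first_path hi hp (by omega) _ _))

theorem nonempty_vtx_equiv_fin (g : ℕ) : Nonempty (Vtx g ≃ Fin (3 * (2 * g + 4))) := by
  refine ⟨(vtxEquiv g).trans (Fintype.equivFinOfCardEq ?_)⟩
  simp only [Fintype.card_sum, Fintype.card_fin, Fintype.card_unit]
  omega

end FragileGraph

open FragileGraph in
/-- For every sufficiently large even `n` there is a simple temporal graph
on `3n` vertices with `Θ(n²)` edges (loopless edge set `E`, one label `ℓ e` per edge) such
that: (i) it is temporally connected; (ii) deleting the temporal edges of any set of at least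
`5n` underlying edges destroys temporal connectivity, so every temporal connectivity
certificate has `Ω(n²)` edges; and yet (iii) after increasing the time label of one single
edge `e₀` (from `ℓ e₀` to some `t₀ > ℓ e₀`), the resulting temporal graph admits a temporally
connected spanning subgraph with at most `6n` edges. -/
theorem stmt_3 :
    ∃ N : ℕ, ∀ n : ℕ, N ≤ n → Even n →
      ∃ (E : Finset (Sym2 (Fin (3 * n)))) (ℓ : Sym2 (Fin (3 * n)) → ℕ),
        (∀ e ∈ E, ¬ e.IsDiag) ∧
        (n ^ 2 ≤ 2 * E.card ∧ E.card ≤ n ^ 2) ∧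
        TConnected {q : Sym2 (Fin (3 * n)) × ℕ | q.1 ∈ E ∧ q.2 = ℓ q.1} ∧
        (∀ F ⊆ E, 5 * n ≤ F.card →
          ¬ TConnected {q : Sym2 (Fin (3 * n)) × ℕ | q.1 ∈ E \ F ∧ q.2 = ℓ q.1}) ∧
        (∀ E' ⊆ E, TConnected {q : Sym2 (Fin (3 * n)) × ℕ | q.1 ∈ E' ∧ q.2 = ℓ q.1} →
          n ^ 2 ≤ 4 * E'.card) ∧
        (∃ e₀ ∈ E, ∃ t₀ : ℕ, ℓ e₀ < t₀ ∧
          ∃ E' ⊆ E, E'.card ≤ 6 * n ∧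
            TConnected {q : Sym2 (Fin (3 * n)) × ℕ |
              q.1 ∈ E' ∧ q.2 = Function.update ℓ e₀ t₀ q.1}) := by
  refine ⟨20, fun n hn heven => ?_⟩
  obtain ⟨g, rfl⟩ : ∃ g, n = 2 * g + 4 := by
    obtain ⟨m, rfl⟩ := heven
    exact ⟨m - 2, by omega⟩
  have hg : 8 ≤ g := by omega
  obtain ⟨φ⟩ := nonempty_vtx_equiv_fin g
  have hcore := card_coreEdges (g := g)
  have houter := card_outerEdges_le (g := g)
  have hunion := Finset.card_union_le (coreEdges g) (outerEdges g)
  have hcore' := Finset.card_le_card (Finset.subset_union_left (s₁ := coreEdges g)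
    (s₂ := outerEdges g))
  have hmem : s(Vtx.mid, Vtx.core 0) ∈ outerEdges g := by simp [outerEdges, hubEdges]
  refine ⟨(coreEdges g ∪ outerEdges g).map (sym2Equiv φ).toEmbedding, label g ∘ (sym2Equiv φ).symm,
    ?_, ⟨?_, ?_⟩, (tConnected_map φ).2 (tConnected_graph (by omega)), ?_, ?_,
    sym2Equiv φ s(.mid, .core 0), Finset.mem_map_of_mem _ (Finset.mem_union_right _ hmem),
    2 * g + 2, ?_, (pathEdges ⟨0, by omega⟩ ∪ outerEdges g).map (sym2Equiv φ).toEmbedding,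
    Finset.map_subset_map.2 (Finset.union_subset_union_left (pathEdges_subset _)), ?_, ?_⟩
  · intro e he
    obtain ⟨e, he', rfl⟩ := Finset.mem_map.1 he
    exact fun h => not_isDiag he' ((Sym2.isDiag_map φ.injective).1 h)
  · rw [Finset.card_map]
    nlinarith
  · rw [Finset.card_map]
    nlinarith
  · intro F hF hcard hconn
    obtain ⟨F, hF', rfl⟩ := Finset.subset_map_iff.1 hF
    rw [← Finset.map_sdiff] at hconn
    have hsub := coreEdges_subset Finset.sdiff_subset ((tConnected_map φ).1 hconn)
    have : F ⊆ outerEdges g := fun e he => (Finset.mem_union.1 (hF' he)).resolve_left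
      fun h => (Finset.mem_sdiff.1 (hsub h)).2 he
    have := Finset.card_le_card this
    rw [Finset.card_map] at hcard
    omega
  · intro E' hE' hconn
    obtain ⟨E', hsub, rfl⟩ := Finset.subset_map_iff.1 hE'
    have := Finset.card_le_card (coreEdges_subset hsub ((tConnected_map φ).1 hconn))
    rw [Finset.card_map]
    nlinarith
  · simp [labelFun]
  · rw [Finset.card_map]
    have := Finset.card_union_le (pathEdges (⟨0, by omega⟩ : Fin g)) (outerEdges g)
    have := card_pathEdges_le (⟨0, by omega⟩ : Fin g)
    omega
  · have := (tConnected_map φ).2 (tConnected_update (i := (⟨0, by omega⟩ : Fin g)) rfl)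
    rwa [Function.update_comp_equiv, Equiv.symm_symm] at this
end
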